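/- Let n ≥ 3, let α, β, γ, ν, μ be real numbers and let 1 < q < ∞. Assume μ > 0. Then the operator S = S_{α,β,γ} is bounded from L^1_ν(Λ_n) into L^q_μ(Λ_n) if and only if the parameters satisfy all three of: (i) γ = α + β + n/2 − ν + μ/q; (ii) γ > 0; (iii) n/2 − 1 − qα < μ < q(γ − α) − n/2 + 1. (This is the paper's Theorem 2.2 instantiated on the rank-2 Lorentz cone, where n/r = n/2.) -/

import Mathlib

open MeasureTheory ENNReal

noncomputable section

/-- The Lorentz determinant `Δ(y) = y₁² − y₂² − ⋯ − y_n²`. -/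
def lDelta (n : ℕ) [NeZero n] (y : Fin n → ℝ) : ℝ :=
  2 * y 0 ^ 2 - ∑ i, y i ^ 2

/-- The Lorentz cone `Λ_n`. -/
def lCone (n : ℕ) [NeZero n] : Set (Fin n → ℝ) :=
  {y | 0 < lDelta n y ∧ 0 < y 0}

/-- The `L^p_ν(Λ_n)` norm `(∫_{Λ_n} |g(y)|^p Δ(y)^{ν−n/2} dy)^{1/p}`. -/
def coneNorm (n : ℕ) [NeZero n] (p ν : ℝ) (g : (Fin n → ℝ) → ℝ) : ℝ≥0∞ :=
  (∫⁻ y in lCone n, ENNReal.ofReal (|g y| ^ p * lDelta n y ^ (ν - (n : ℝ) / 2))) ^ (1 / p)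

/-- The operator `S_{α,β,γ}` applied to `|g|`:
`S|g|(y) = Δ(y)^α ∫_{Λ_n} Δ(y+x)^{−γ} |g(x)| Δ(x)^β dx`. -/
def Sop (n : ℕ) [NeZero n] (α β γ : ℝ) (g : (Fin n → ℝ) → ℝ) (y : Fin n → ℝ) : ℝ≥0∞ :=
  ENNReal.ofReal (lDelta n y ^ α) *
    ∫⁻ x in lCone n, ENNReal.ofReal (lDelta n (y + x) ^ (-γ) * |g x| * lDelta n x ^ β)

/-- The `L^q_μ(Λ_n)` norm of `S_{α,β,γ}|g|`. -/
def SopNorm (n : ℕ) [NeZero n] (α β γ q μ : ℝ) (g : (Fin n → ℝ) → ℝ) : ℝ≥0∞ :=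
  (∫⁻ y in lCone n, Sop n α β γ g y ^ q * ENNReal.ofReal (lDelta n y ^ (μ - (n : ℝ) / 2))) ^ (1 / q)

/-- `S_{α,β,γ}` is bounded from `L^p_ν(Λ_n)` to `L^q_μ(Λ_n)`:
`‖S|g|‖_{q,μ} ≤ C ‖g‖_{p,ν}` for every `g ∈ L^p_ν(Λ_n)`. -/
def SBounded (n : ℕ) [NeZero n] (α β γ p ν q μ : ℝ) : Prop :=
  ∃ C > (0 : ℝ), ∀ g : (Fin n → ℝ) → ℝ, Measurable g → coneNorm n p ν g < ⊤ →
    SopNorm n α β γ q μ g ≤ ENNReal.ofReal C * coneNorm n p ν g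

theorem lintegral_fun_norm_addHaar {E : Type*} [NormedAddCommGroup E] [NormedSpace ℝ E]
    [FiniteDimensional ℝ E] [MeasurableSpace E] [BorelSpace E] [Nontrivial E] (μ : Measure E)
    [μ.IsAddHaarMeasure] {f : ℝ → ℝ≥0∞} (hf : Measurable f) :
    ∫⁻ x, f ‖x‖ ∂μ = μ.toSphere Set.univ *
      ∫⁻ r in Set.Ioi (0 : ℝ), ENNReal.ofReal (r ^ (Module.finrank ℝ E - 1)) * f r := by
  have hfs : Measurable fun x : Set.Ioi (0 : ℝ) ↦ f x := hf.comp measurable_subtype_coe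
  calc
    ∫⁻ x, f ‖x‖ ∂μ = ∫⁻ x : ({(0)}ᶜ : Set E), f ‖x.1‖ ∂(μ.comap (↑)) := by
      rw [lintegral_subtype_comap (measurableSet_singleton _).compl fun x ↦ f ‖x‖,
        restrict_compl_singleton]
    _ = ∫⁻ x, f x.2 ∂μ.toSphere.prod (.volumeIoiPow (Module.finrank ℝ E - 1)) := by
      simpa using μ.measurePreserving_homeomorphUnitSphereProd.lintegral_comp
        (f := fun x ↦ f x.2) (hfs.comp measurable_snd)
    _ = μ.toSphere Set.univ *
        ∫⁻ x : Set.Ioi (0 : ℝ), f x ∂.volumeIoiPow (Module.finrank ℝ E - 1) := by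
      rw [lintegral_prod (fun x : _ × Set.Ioi (0 : ℝ) ↦ f x.2) (hfs.comp measurable_snd).aemeasurable]
      simp [mul_comm]
    _ = _ := by
      rw [Measure.volumeIoiPow, lintegral_withDensity_eq_lintegral_mul _ (by fun_prop) hfs]
      simp only [Pi.mul_apply]
      rw [lintegral_subtype_comap measurableSet_Ioi
        fun a ↦ ENNReal.ofReal (a ^ (Module.finrank ℝ E - 1)) * f a]

section Lorentz

variable {n : ℕ} [NeZero n]

/-- The Euclidean norm of the spatial part of `y`. -/
def spatialNorm (y : Fin n → ℝ) : ℝ := √(y 0 ^ 2 - lDelta n y)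

theorem sq_sub_lDelta_nonneg (y : Fin n → ℝ) : 0 ≤ y 0 ^ 2 - lDelta n y := by
  have := Finset.single_le_sum (f := fun i ↦ y i ^ 2) (fun i _ ↦ sq_nonneg _) (Finset.mem_univ 0)
  simp only [lDelta]
  linarith

theorem lDelta_eq_mul (y : Fin n → ℝ) :
    lDelta n y = (y 0 - spatialNorm y) * (y 0 + spatialNorm y) := by
  have := Real.sq_sqrt (sq_sub_lDelta_nonneg y)
  rw [spatialNorm]
  linarith

theorem spatialNorm_nonneg (y : Fin n → ℝ) : 0 ≤ spatialNorm y := Real.sqrt_nonneg _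

theorem mem_lCone_iff (y : Fin n → ℝ) : y ∈ lCone n ↔ spatialNorm y < y 0 := by
  have h0 := spatialNorm_nonneg y
  simp only [lCone, Set.mem_ofPred_eq, lDelta_eq_mul]
  constructor
  · rintro ⟨h1, h2⟩
    have : 0 < y 0 + spatialNorm y := by linarith
    have := (mul_pos_iff_of_pos_right this).1 h1
    linarith
  · intro h
    exact ⟨mul_pos (by linarith) (by linarith), by linarith⟩

@[fun_prop]
theorem continuous_lDelta : Continuous (lDelta n) := by
  unfold lDelta
  fun_prop

@[fun_prop]
theorem measurable_lDelta : Measurable (lDelta n) := continuous_lDelta.measurable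

theorem isOpen_lCone : IsOpen (lCone n) :=
  (isOpen_lt continuous_const continuous_lDelta).inter
    (isOpen_lt continuous_const (continuous_apply 0))

theorem measurableSet_lCone : MeasurableSet (lCone n) := isOpen_lCone.measurableSet

/-- Integration in polar coordinates over the Lorentz cone. -/
theorem exists_lintegral_lCone_eq (hn : 2 ≤ n) : ∃ c : ℝ≥0∞, c ≠ 0 ∧ c ≠ ⊤ ∧
    ∀ F : ℝ × ℝ → ℝ≥0∞, Measurable F → ∫⁻ y in lCone n, F (y 0, spatialNorm y) =
      c * ∫⁻ r in Set.Ioi (0 : ℝ), ENNReal.ofReal (r ^ (n - 2)) *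
        ∫⁻ u in Set.Ioi (0 : ℝ), F (r + u, r) := by
  obtain ⟨m, rfl⟩ : ∃ m, n = m + 1 := ⟨n - 1, by omega⟩
  have : Nonempty (Fin m) := ⟨⟨0, by omega⟩⟩
  refine ⟨(volume : Measure (EuclideanSpace ℝ (Fin m))).toSphere Set.univ, ?_, measure_ne_top _ _,
    fun F hF ↦ ?_⟩
  · rw [ne_eq, Measure.measure_univ_eq_zero]
    exact Measure.toSphere_ne_zero _
  set G : ℝ × ℝ → ℝ≥0∞ := {p : ℝ × ℝ | p.2 < p.1}.indicator F with hG
  have hGm : Measurable G := hF.indicator (measurableSet_lt measurable_snd measurable_fst)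
  have hnorm (y : Fin (m + 1) → ℝ) :
      spatialNorm y = ‖WithLp.toLp 2 (fun i : Fin m ↦ y i.succ)‖ := by
    rw [spatialNorm, EuclideanSpace.norm_eq, lDelta, Fin.sum_univ_succ]
    congr 1
    simp
    ring
  calc
    _ = ∫⁻ y : Fin (m + 1) → ℝ, G (y 0, ‖WithLp.toLp 2 (fun i : Fin m ↦ y i.succ)‖) := by
      rw [← lintegral_indicator measurableSet_lCone]
      congr 1 with y
      simp [hG, Set.indicator, mem_lCone_iff, ← hnorm]
    _ = ∫⁻ p : ℝ × (Fin m → ℝ), G (p.1, ‖WithLp.toLp 2 p.2‖) := by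
      rw [← (volume_preserving_piFinSuccAbove (fun _ : Fin (m + 1) ↦ ℝ) 0).lintegral_comp_emb
        (MeasurableEquiv.measurableEmbedding _)]
      rfl
    _ = ∫⁻ z : Fin m → ℝ, ∫⁻ t, G (t, ‖WithLp.toLp 2 z‖) := by
      rw [Measure.volume_eq_prod, lintegral_prod_symm']
      fun_prop
    _ = ∫⁻ z : EuclideanSpace ℝ (Fin m), ∫⁻ t, G (t, ‖z‖) :=
      (PiLp.volume_preserving_toLp (Fin m)).lintegral_comp_emb
        (MeasurableEquiv.toLp 2 (Fin m → ℝ)).measurableEmbedding (fun z ↦ ∫⁻ t, G (t, ‖z‖))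
    _ = _ := by
      rw [lintegral_fun_norm_addHaar (f := fun r ↦ ∫⁻ t, G (t, r)) _ hGm.lintegral_prod_left']
      congr 1
      refine setLIntegral_congr_fun measurableSet_Ioi fun r _ ↦ ?_
      simp only [finrank_euclideanSpace, Fintype.card_fin]
      congr 1
      rw [← lintegral_indicator measurableSet_Ioi,
        ← lintegral_add_left_eq_self (fun t ↦ G (t, r)) r]
      congr 1 with u
      simp [hG, Set.indicator]

/-- The Lorentz bilinear form, polarizing `lDelta`. -/
def lBilin (n : ℕ) [NeZero n] : (Fin n → ℝ) →ₗ[ℝ] (Fin n → ℝ) →ₗ[ℝ] ℝ :=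
  LinearMap.mk₂ ℝ (fun x y ↦ 2 * x 0 * y 0 - ∑ i, x i * y i)
    (fun x x' y ↦ by simp only [Pi.add_apply, add_mul, Finset.sum_add_distrib]; ring)
    (fun c x y ↦ by simp only [Pi.smul_apply, smul_eq_mul, mul_assoc, ← Finset.mul_sum]; ring)
    (fun x y y' ↦ by simp only [Pi.add_apply, mul_add, Finset.sum_add_distrib]; ring)
    (fun c x y ↦ by
      simp only [Pi.smul_apply, smul_eq_mul, mul_left_comm _ c, ← Finset.mul_sum]; ring)

theorem lBilin_apply (x y : Fin n → ℝ) : lBilin n x y = 2 * x 0 * y 0 - ∑ i, x i * y i := rfl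

theorem lBilin_comm (x y : Fin n → ℝ) : lBilin n x y = lBilin n y x := by
  simp only [lBilin_apply, mul_comm (x _)]
  ring

theorem lDelta_eq_lBilin (x : Fin n → ℝ) : lDelta n x = lBilin n x x := by
  simp only [lBilin_apply, lDelta, pow_two, mul_assoc]

theorem lDelta_add (x y : Fin n → ℝ) :
    lDelta n (x + y) = lDelta n x + lDelta n y + 2 * lBilin n x y := by
  simp only [lDelta_eq_lBilin, map_add, LinearMap.add_apply, lBilin_comm y x]
  ring

theorem lDelta_smul (c : ℝ) (x : Fin n → ℝ) : lDelta n (c • x) = c ^ 2 * lDelta n x := by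
  simp only [lDelta_eq_lBilin, map_smul, LinearMap.smul_apply, smul_eq_mul]
  ring

theorem lBilin_single (y : Fin n → ℝ) : lBilin n (Pi.single 0 1) y = y 0 := by
  simp [lBilin_apply, Pi.single_apply]
  ring

theorem lDelta_single : lDelta n (Pi.single 0 1) = 1 := by
  simp [lDelta_eq_lBilin, lBilin_single]

theorem single_mem_lCone : (Pi.single 0 1 : Fin n → ℝ) ∈ lCone n := by
  simp [lCone, lDelta_single]

theorem smul_mem_lCone {c : ℝ} (hc : 0 < c) {x : Fin n → ℝ} (hx : x ∈ lCone n) :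
    c • x ∈ lCone n :=
  ⟨by rw [lDelta_smul]; exact mul_pos (by positivity) hx.1, mul_pos hc hx.2⟩

theorem lDelta_eq_sub_sum (y : Fin n → ℝ) :
    lDelta n y = y 0 ^ 2 - ∑ i ∈ Finset.univ.erase 0, y i ^ 2 := by
  rw [lDelta, ← Finset.add_sum_erase _ _ (Finset.mem_univ 0)]
  ring

theorem lBilin_pos {x y : Fin n → ℝ} (hx : x ∈ lCone n) (hy : y ∈ lCone n) :
    0 < lBilin n x y := by
  have hCS := Finset.sum_mul_sq_le_sq_mul_sq (Finset.univ.erase 0) x y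
  obtain ⟨hx1, hx0⟩ := hx
  obtain ⟨hy1, hy0⟩ := hy
  rw [lDelta_eq_sub_sum] at hx1 hy1
  rw [lBilin_apply, ← Finset.add_sum_erase _ _ (Finset.mem_univ 0)]
  have h1 : (∑ i ∈ Finset.univ.erase 0, x i ^ 2) * (∑ i ∈ Finset.univ.erase 0, y i ^ 2)
      < x 0 ^ 2 * y 0 ^ 2 :=
    mul_lt_mul'' (by linarith) (by linarith) (Finset.sum_nonneg fun _ _ ↦ sq_nonneg _)
      (Finset.sum_nonneg fun _ _ ↦ sq_nonneg _)
  have h2 : (∑ i ∈ Finset.univ.erase 0, x i * y i) ^ 2 < (x 0 * y 0) ^ 2 := by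
    rw [mul_pow]
    exact hCS.trans_lt h1
  have := lt_of_abs_lt (sq_lt_sq.1 h2 |>.trans_eq (abs_of_pos (mul_pos hx0 hy0)))
  linarith

theorem lDelta_lt_lDelta_add {x y : Fin n → ℝ} (hx : x ∈ lCone n) (hy : y ∈ lCone n) :
    lDelta n x < lDelta n (x + y) := by
  rw [lDelta_add]
  linarith [hy.1, lBilin_pos hx hy]

theorem add_mem_lCone {x y : Fin n → ℝ} (hx : x ∈ lCone n) (hy : y ∈ lCone n) :
    x + y ∈ lCone n :=
  ⟨hx.1.trans (lDelta_lt_lDelta_add hx hy), add_pos hx.2 hy.2⟩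

theorem abs_apply_le_of_mem_lCone {y : Fin n → ℝ} (hy : y ∈ lCone n) (i : Fin n) :
    |y i| ≤ y 0 := by
  rcases eq_or_ne i 0 with rfl | hi
  · rw [abs_of_pos hy.2]
  have h1 := hy.1
  rw [lDelta_eq_sub_sum] at h1
  have h2 := Finset.single_le_sum (f := fun i ↦ y i ^ 2) (fun i _ ↦ sq_nonneg _)
    (Finset.mem_erase.2 ⟨hi, Finset.mem_univ i⟩)
  exact abs_le_of_sq_le_sq (by linarith) hy.2.le

/-- The Lorentz involution exchanging the base point `Pi.single 0 1` with `x`,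
when `lDelta n x = 1`. -/
def lInvolution (x : Fin n → ℝ) : (Fin n → ℝ) →ₗ[ℝ] (Fin n → ℝ) :=
  (1 + x 0)⁻¹ • (lBilin n (Pi.single 0 1 + x)).smulRight (Pi.single 0 1 + x) - LinearMap.id

theorem lInvolution_apply (x y : Fin n → ℝ) :
    lInvolution x y = ((1 + x 0)⁻¹ * (y 0 + lBilin n x y)) • (Pi.single 0 1 + x) - y := by
  simp [lInvolution, lBilin_single, mul_smul]

theorem lInvolution_single {x : Fin n → ℝ} (hx0 : 0 < x 0) :
    lInvolution x (Pi.single 0 1) = x := by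
  have : (1 + x 0) ≠ 0 := by positivity
  rw [lInvolution_apply, lBilin_comm, lBilin_single, Pi.single_eq_same, inv_mul_cancel₀ this,
    one_smul, add_sub_cancel_left]

theorem lBilin_lInvolution {x : Fin n → ℝ} (hx : lDelta n x = 1) (hx0 : 0 < x 0)
    (y z : Fin n → ℝ) : lBilin n (lInvolution x y) (lInvolution x z) = lBilin n y z := by
  have h : (1 + x 0) ≠ 0 := by positivity
  rw [lDelta_eq_lBilin] at hx
  have h1 : lBilin n x (Pi.single 0 1) = x 0 := by rw [lBilin_comm, lBilin_single]
  have h2 : lBilin n y (Pi.single 0 1) = y 0 := by rw [lBilin_comm, lBilin_single]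
  simp only [lInvolution_apply, map_add, map_sub, map_smul, LinearMap.add_apply,
    LinearMap.sub_apply, LinearMap.smul_apply, lBilin_single, h1, h2, hx, smul_eq_mul,
    Pi.single_eq_same, lBilin_comm y x]
  field_simp
  ring

theorem lInvolution_lInvolution {x : Fin n → ℝ} (hx : lDelta n x = 1) (hx0 : 0 < x 0)
    (y : Fin n → ℝ) : lInvolution x (lInvolution x y) = y := by
  have h : (1 + x 0) ≠ 0 := by positivity
  have hw : lInvolution x (Pi.single 0 1 + x) = Pi.single 0 1 + x := by
    have h1 : lBilin n x (Pi.single 0 1 + x) = x 0 + 1 := by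
      rw [map_add, ← lDelta_eq_lBilin, hx, lBilin_comm, lBilin_single]
    rw [lInvolution_apply, h1, Pi.add_apply, Pi.single_eq_same,
      show (1 + x 0)⁻¹ * (1 + x 0 + (x 0 + 1)) = 2 by field_simp; ring, two_smul,
      add_sub_cancel_right]
  conv_lhs => rw [lInvolution_apply x y, map_sub, map_smul, hw, lInvolution_apply x y]
  abel

theorem lDelta_lInvolution {x : Fin n → ℝ} (hx : lDelta n x = 1) (hx0 : 0 < x 0)
    (y : Fin n → ℝ) : lDelta n (lInvolution x y) = lDelta n y := by
  simp only [lDelta_eq_lBilin, lBilin_lInvolution hx hx0]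

theorem lInvolution_mem_lCone {x y : Fin n → ℝ} (hx : lDelta n x = 1) (hx0 : 0 < x 0)
    (hy : y ∈ lCone n) : lInvolution x y ∈ lCone n := by
  refine ⟨by rw [lDelta_lInvolution hx hx0]; exact hy.1, ?_⟩
  rw [← lBilin_single (lInvolution x y), ← lBilin_lInvolution hx hx0, lInvolution_single hx0,
    lInvolution_lInvolution hx hx0]
  exact lBilin_pos ⟨by rw [hx]; exact one_pos, hx0⟩ hy

end Lorentz

theorem measurePreserving_of_involutive {E : Type*} [NormedAddCommGroup E] [NormedSpace ℝ E]
    [FiniteDimensional ℝ E] [MeasurableSpace E] [BorelSpace E] (μ : Measure E)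
    [μ.IsAddHaarMeasure] {f : E →ₗ[ℝ] E} (hf : ∀ x, f (f x) = x) : MeasurePreserving f μ μ := by
  have hdet : LinearMap.det f * LinearMap.det f = 1 := by
    rw [← LinearMap.det_comp, LinearMap.ext (f := f ∘ₗ f) (g := LinearMap.id) hf,
      LinearMap.det_id]
  refine ⟨f.continuous_of_finiteDimensional.measurable, ?_⟩
  rw [Measure.map_linearMap_addHaar_eq_smul_addHaar μ (left_ne_zero_of_mul_eq_one hdet)]
  rcases mul_self_eq_one_iff.1 hdet with h | h <;> simp [h]

theorem lintegral_comp_smul {E : Type*} [NormedAddCommGroup E] [NormedSpace ℝ E]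
    [FiniteDimensional ℝ E] [MeasurableSpace E] [BorelSpace E] (μ : Measure E)
    [μ.IsAddHaarMeasure] {c : ℝ} (hc : 0 < c) (f : E → ℝ≥0∞) :
    ENNReal.ofReal (c ^ Module.finrank ℝ E) * ∫⁻ x, f (c • x) ∂μ = ∫⁻ x, f x ∂μ := by
  have h := Measure.map_addHaar_smul μ hc.ne'
  have h2 : ∫⁻ x, f (c • x) ∂μ = ∫⁻ x, f x ∂(Measure.map (c • ·) μ) :=
    (lintegral_map_equiv f (Homeomorph.smulOfNeZero c hc.ne').toMeasurableEquiv).symm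
  rw [h2, h, lintegral_smul_measure, smul_eq_mul, ← mul_assoc, ← ENNReal.ofReal_mul (by positivity),
    abs_of_nonneg (by positivity), mul_inv_cancel₀ (by positivity), ENNReal.ofReal_one, one_mul]

section Lorentz

variable {n : ℕ} [NeZero n]

theorem setLIntegral_lCone_comp_smul {c : ℝ} (hc : 0 < c) (f : (Fin n → ℝ) → ℝ≥0∞) :
    ENNReal.ofReal (c ^ n) * ∫⁻ x in lCone n, f (c • x) = ∫⁻ x in lCone n, f x := by
  rw [← lintegral_indicator measurableSet_lCone, ← lintegral_indicator measurableSet_lCone,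
    ← lintegral_comp_smul _ hc ((lCone n).indicator f), Module.finrank_fin_fun]
  congr 1
  refine lintegral_congr fun x ↦ ?_
  have : c • x ∈ lCone n ↔ x ∈ lCone n :=
    ⟨fun h ↦ by simpa [smul_smul, hc.ne'] using smul_mem_lCone (inv_pos.2 hc) h, smul_mem_lCone hc⟩
  by_cases hx : x ∈ lCone n
  · rw [Set.indicator_of_mem hx, Set.indicator_of_mem (this.2 hx)]
  · rw [Set.indicator_of_notMem hx, Set.indicator_of_notMem (this.not.2 hx)]

theorem setLIntegral_lCone_comp_lInvolution {x : Fin n → ℝ} (hx : lDelta n x = 1) (hx0 : 0 < x 0)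
    {f : (Fin n → ℝ) → ℝ≥0∞} (hf : Measurable f) :
    ∫⁻ y in lCone n, f (lInvolution x y) = ∫⁻ y in lCone n, f y := by
  have h := measurePreserving_of_involutive volume (lInvolution_lInvolution hx hx0)
  rw [← h.setLIntegral_comp_preimage measurableSet_lCone hf]
  congr 3 with y
  exact ⟨lInvolution_mem_lCone hx hx0, fun hy ↦ by
    simpa [lInvolution_lInvolution hx hx0] using lInvolution_mem_lCone hx hx0 hy⟩

/-- The integral over the cone of `Δ(y)^a Δ(x+y)^{-t}`. -/
def coneBeta (n : ℕ) [NeZero n] (a t : ℝ) (x : Fin n → ℝ) : ℝ≥0∞ :=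
  ∫⁻ y in lCone n, ENNReal.ofReal (lDelta n y ^ a * lDelta n (x + y) ^ (-t))

theorem coneBeta_eq {x : Fin n → ℝ} (hx : x ∈ lCone n) (a t : ℝ) :
    coneBeta n a t x =
      ENNReal.ofReal (lDelta n x ^ (a - t + n / 2)) * coneBeta n a t (Pi.single 0 1) := by
  set c := √(lDelta n x) with hc_def
  have hc : 0 < c := Real.sqrt_pos.2 hx.1
  have hc2 : c ^ 2 = lDelta n x := Real.sq_sqrt hx.1.le
  set x₁ := c⁻¹ • x with hx₁_def
  have hxx : x = c • x₁ := by rw [hx₁_def, smul_smul, mul_inv_cancel₀ hc.ne', one_smul]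
  have hx₁ : lDelta n x₁ = 1 := by
    rw [hx₁_def, lDelta_smul, ← hc2, ← mul_pow, inv_mul_cancel₀ hc.ne', one_pow]
  have hx₁0 : 0 < x₁ 0 := (smul_mem_lCone (inv_pos.2 hc) hx).2
  have h1 : coneBeta n a t x₁ = coneBeta n a t (Pi.single 0 1) := by
    rw [coneBeta, ← setLIntegral_lCone_comp_lInvolution hx₁ hx₁0 (by fun_prop), coneBeta]
    refine lintegral_congr fun y ↦ ?_
    have h2 : x₁ + lInvolution x₁ y = lInvolution x₁ (Pi.single 0 1 + y) := by
      rw [map_add, lInvolution_single hx₁0]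
    rw [h2, lDelta_lInvolution hx₁ hx₁0, lDelta_lInvolution hx₁ hx₁0]
  rw [← h1, coneBeta, ← setLIntegral_lCone_comp_smul hc, coneBeta, ← lintegral_const_mul' _ _ (by simp),
    ← lintegral_const_mul' _ _ (by simp)]
  refine setLIntegral_congr_fun measurableSet_lCone fun y hy ↦ ?_
  have hx₁c : x₁ ∈ lCone n := smul_mem_lCone (inv_pos.2 hc) hx
  have hd := (add_mem_lCone hx₁c hy).1
  have hxp : 0 < lDelta n x := hx.1
  rw [← ENNReal.ofReal_mul (by positivity), ← ENNReal.ofReal_mul (by positivity)]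
  conv_lhs => rw [hxx]
  rw [← smul_add, lDelta_smul, lDelta_smul, Real.mul_rpow (by positivity) hy.1.le,
    Real.mul_rpow (by positivity) hd.le, hc2, Real.rpow_add hxp, Real.rpow_sub hxp,
    Real.rpow_neg hxp.le, show c ^ n = lDelta n x ^ ((n : ℝ) / 2) by
      rw [← hc2, ← Real.rpow_natCast, ← Real.rpow_natCast, ← Real.rpow_mul hc.le]
      congr 1
      push_cast
      ring]
  congr 1
  ring

theorem exists_coneBeta_single_eq (hn : 2 ≤ n) (a t : ℝ) : ∃ k : ℝ≥0∞, k ≠ 0 ∧ k ≠ ⊤ ∧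
    ∀ c : ℝ, coneBeta n a t (c • Pi.single 0 1) =
      k * ∫⁻ r in Set.Ioi (0 : ℝ), ∫⁻ u in Set.Ioi (0 : ℝ), ENNReal.ofReal (r ^ (n - 2)) *
        ENNReal.ofReal ((u * (u + 2 * r)) ^ a * ((u + c) * (u + 2 * r + c)) ^ (-t)) := by
  obtain ⟨k, hk0, hk, h⟩ := exists_lintegral_lCone_eq hn
  refine ⟨k, hk0, hk, fun c ↦ ?_⟩
  have h1 := h (fun p ↦ ENNReal.ofReal (((p.1 - p.2) * (p.1 + p.2)) ^ a *
    ((p.1 - p.2 + c) * (p.1 + p.2 + c)) ^ (-t))) (by fun_prop)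
  rw [coneBeta]
  convert h1 using 1
  · refine lintegral_congr fun y ↦ ?_
    have : lDelta n (c • Pi.single 0 1 + y) =
        (y 0 - spatialNorm y + c) * (y 0 + spatialNorm y + c) := by
      rw [lDelta_add, lDelta_smul, lDelta_single, map_smul, LinearMap.smul_apply, lBilin_single,
        smul_eq_mul, lDelta_eq_mul]
      ring
    rw [this, lDelta_eq_mul]
  · congr 1
    refine lintegral_congr fun r ↦ ?_
    rw [← lintegral_const_mul' _ _ (by simp)]
    refine lintegral_congr fun u ↦ ?_
    congr! 4 <;> ring

end Lorentz

theorem lintegral_rpow_mul_one_add_rpow_lt_top {b t : ℝ} (hb : -1 < b)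
    (hbt : b - t < -1) :
    ∫⁻ v in Set.Ioi (0 : ℝ), ENNReal.ofReal (v ^ b * (1 + v) ^ (-t)) < ⊤ := by
  rw [← Set.Ioo_union_Ici_eq_Ioi (zero_lt_one' ℝ)]
  refine (lintegral_union_le _ _ _).trans_lt (ENNReal.add_lt_top.2 ⟨?_, ?_⟩)
  · have h := (intervalIntegral.integrableOn_Ioo_rpow_iff (zero_lt_one' ℝ)).2 hb
    refine lt_of_le_of_lt (setLIntegral_mono' measurableSet_Ioo fun v hv ↦ ?_)
      h.lintegral_lt_top
    have := hv.1
    exact ENNReal.ofReal_le_ofReal (mul_le_of_le_one_right (by positivity)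
      (Real.rpow_le_one_of_one_le_of_nonpos (by linarith) (by linarith)))
  · have h := (integrableOn_Ioi_rpow_iff (zero_lt_one' ℝ)).2 hbt
    rw [← integrableOn_Ici_iff_integrableOn_Ioi] at h
    refine lt_of_le_of_lt (setLIntegral_mono' measurableSet_Ici fun v hv ↦ ?_)
      h.lintegral_lt_top
    have hv : 1 ≤ v := hv
    have hv0 : 0 < v := by linarith
    refine ENNReal.ofReal_le_ofReal ?_
    rw [sub_eq_add_neg, Real.rpow_add hv0]
    gcongr ?_ * ?_
    exact Real.rpow_le_rpow_of_nonpos hv0 (by linarith) (by linarith)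

theorem setLIntegral_Ioi_comp_add_mul_le {u c : ℝ} (hu : 0 < u) (hc : 1 ≤ c) (f : ℝ → ℝ≥0∞) :
    ∫⁻ r in Set.Ioi (0 : ℝ), f (u + c * r) ≤ ∫⁻ v in Set.Ioi (0 : ℝ), f v := by
  have hc0 : 0 < c := by linarith
  rw [← lintegral_indicator measurableSet_Ioi, ← lintegral_indicator measurableSet_Ioi,
    ← lintegral_add_left_eq_self ((Set.Ioi 0).indicator f) u,
    ← lintegral_comp_smul _ hc0 fun r ↦ (Set.Ioi 0).indicator f (u + r)]
  have h1 : 1 ≤ ENNReal.ofReal (c ^ Module.finrank ℝ ℝ) := by simpa using hc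
  refine le_mul_of_one_le_of_le h1 (lintegral_mono fun r ↦ ?_)
  by_cases hr : 0 < r
  · have : 0 < u + c * r := by positivity
    simp [hr, this]
  · simp [hr]

theorem exists_pos_le_rpow {A : ℝ} (B : ℝ) (hA : 0 < A) (p : ℝ) :
    ∃ k > 0, ∀ x, A ≤ x → x ≤ B → k ≤ x ^ p := by
  rcases le_total 0 p with hp | hp
  · exact ⟨A ^ p, by positivity, fun x h1 _ ↦ Real.rpow_le_rpow hA.le h1 hp⟩
  · by_cases hB : 0 < B
    · exact ⟨B ^ p, by positivity, fun x h1 h2 ↦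
        Real.rpow_le_rpow_of_nonpos (hA.trans_le h1) h2 hp⟩
    · exact ⟨1, one_pos, fun x h1 h2 ↦ by linarith⟩

theorem lintegral_rpow_Ioo_eq_top {a : ℝ} (ha : a ≤ -1) :
    ∫⁻ u in Set.Ioo (0 : ℝ) 1, ENNReal.ofReal (u ^ a) = ⊤ := by
  by_contra h
  refine (not_lt.2 ha) ((intervalIntegral.integrableOn_Ioo_rpow_iff (zero_lt_one' ℝ)).1 ?_)
  refine (lintegral_ofReal_ne_top_iff_integrable (by fun_prop) ?_).1 h
  filter_upwards [ae_restrict_mem measurableSet_Ioo] with x hx using Real.rpow_nonneg hx.1.le _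

theorem lintegral_rpow_Ioi_eq_top {a : ℝ} (ha : -1 ≤ a) :
    ∫⁻ u in Set.Ioi (1 : ℝ), ENNReal.ofReal (u ^ a) = ⊤ := by
  by_contra h
  refine (not_lt.2 ha) ((integrableOn_Ioi_rpow_iff (zero_lt_one' ℝ)).1 ?_)
  refine (lintegral_ofReal_ne_top_iff_integrable (by fun_prop) ?_).1 h
  filter_upwards [ae_restrict_mem measurableSet_Ioi] with x hx using
    Real.rpow_nonneg (zero_le_one.trans hx.le) _

section Lorentz

variable {n : ℕ} [NeZero n]

theorem coneBeta_single_lt_top (hn : 2 ≤ n) {a t : ℝ} (ha : -1 < a)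
    (hat : a - t + n - 2 < -1) : coneBeta n a t (Pi.single 0 1) < ⊤ := by
  obtain ⟨k, hk0, hk, h⟩ := exists_coneBeta_single_eq hn a t
  have hn' : (2 : ℝ) ≤ n := by exact_mod_cast hn
  rw [← one_smul ℝ (Pi.single 0 1), h]
  refine ENNReal.mul_lt_top hk.lt_top ?_
  set φ : ℝ → ℝ≥0∞ := fun u ↦ ENNReal.ofReal (u ^ a * (1 + u) ^ (-t)) with hφ
  set ψ : ℝ → ℝ≥0∞ := fun v ↦ ENNReal.ofReal (v ^ (a + (n - 2)) * (1 + v) ^ (-t)) with hψ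
  have hφi : ∫⁻ u in Set.Ioi (0 : ℝ), φ u < ⊤ :=
    lintegral_rpow_mul_one_add_rpow_lt_top ha (by linarith)
  have hψi : ∫⁻ u in Set.Ioi (0 : ℝ), ψ u < ⊤ :=
    lintegral_rpow_mul_one_add_rpow_lt_top (by linarith) (by linarith)
  calc
    _ ≤ ∫⁻ r in Set.Ioi (0 : ℝ), ∫⁻ u in Set.Ioi (0 : ℝ), φ u * ψ (u + 2 * r) := by
      refine setLIntegral_mono' measurableSet_Ioi fun r hr ↦
        setLIntegral_mono' measurableSet_Ioi fun u hu ↦ ?_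
      have hr : 0 < r := hr
      have hu : 0 < u := hu
      have hv : 0 < u + 2 * r := by positivity
      rw [hφ, hψ, ← ENNReal.ofReal_mul (by positivity), ← ENNReal.ofReal_mul (by positivity)]
      refine ENNReal.ofReal_le_ofReal ?_
      rw [Real.rpow_add hv, Real.mul_rpow hu.le hv.le, Real.mul_rpow (by positivity) (by positivity),
        add_comm u 1, add_comm _ (1 : ℝ)]
      have h2 : r ^ (n - 2) ≤ (u + 2 * r) ^ ((n : ℝ) - 2) := by
        rw [show (n : ℝ) - 2 = ((n - 2 : ℕ) : ℝ) by push_cast [hn]; ring, Real.rpow_natCast]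
        exact pow_le_pow_left₀ hr.le (by linarith) _
      calc
        _ ≤ (u + 2 * r) ^ ((n : ℝ) - 2) * (u ^ a * (u + 2 * r) ^ a *
              ((1 + u) ^ (-t) * (1 + (u + 2 * r)) ^ (-t))) := by gcongr
        _ = _ := by ring
    _ = ∫⁻ u in Set.Ioi (0 : ℝ), ∫⁻ r in Set.Ioi (0 : ℝ), φ u * ψ (u + 2 * r) := by
      rw [lintegral_lintegral_swap]
      fun_prop
    _ ≤ ∫⁻ u in Set.Ioi (0 : ℝ), φ u * ∫⁻ v in Set.Ioi (0 : ℝ), ψ v := by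
      refine setLIntegral_mono' measurableSet_Ioi fun u hu ↦ ?_
      rw [lintegral_const_mul' _ _ (by simp [hφ])]
      refine mul_le_mul_right ?_ _
      exact setLIntegral_Ioi_comp_add_mul_le hu one_le_two ψ
    _ < ⊤ := by
      rw [lintegral_mul_const' _ _ hψi.ne]
      exact ENNReal.mul_lt_top hφi hψi

theorem lt_of_coneBeta_lt_top (hn : 2 ≤ n) {a t c : ℝ} (hc : 0 < c)
    (h : coneBeta n a t (c • Pi.single 0 1) < ⊤) : -1 < a ∧ a - t + n - 2 < -1 := by
  obtain ⟨k, hk0, hk, hk'⟩ := exists_coneBeta_single_eq hn a t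
  rw [hk'] at h
  have hcast : ((n - 2 : ℕ) : ℝ) = n - 2 := by push_cast [hn]; ring
  constructor
  · by_contra! ha
    refine h.ne (ENNReal.mul_eq_top.2 (.inl ⟨hk0, ?_⟩))
    obtain ⟨k₁, hk₁, hk₁'⟩ := exists_pos_le_rpow 5 two_pos a
    obtain ⟨k₂, hk₂, hk₂'⟩ := exists_pos_le_rpow ((1 + c) * (5 + c))
      (show 0 < c * (2 + c) by positivity) (-t)
    have hK : 0 < k₁ * k₂ := by positivity
    refine top_unique ?_
    calc
      ⊤ = ∫⁻ r in Set.Ioo (1 : ℝ) 2, ∫⁻ u in Set.Ioo (0 : ℝ) 1,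
            ENNReal.ofReal (k₁ * k₂) * ENNReal.ofReal (u ^ a) := by
        rw [lintegral_const_mul' _ _ (by simp), lintegral_rpow_Ioo_eq_top ha]
        rw [ENNReal.mul_top (by simpa using hK)]
        simp
      _ ≤ ∫⁻ r in Set.Ioo (1 : ℝ) 2, ∫⁻ u in Set.Ioo (0 : ℝ) 1, ENNReal.ofReal (r ^ (n - 2)) *
          ENNReal.ofReal ((u * (u + 2 * r)) ^ a * ((u + c) * (u + 2 * r + c)) ^ (-t)) := by
        refine setLIntegral_mono' measurableSet_Ioo fun r ⟨hr1, hr2⟩ ↦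
          setLIntegral_mono' measurableSet_Ioo fun u ⟨hu0, hu1⟩ ↦ ?_
        rw [← ENNReal.ofReal_mul (by positivity), ← ENNReal.ofReal_mul (by positivity)]
        refine ENNReal.ofReal_le_ofReal ?_
        have e1 := hk₁' (u + 2 * r) (by linarith) (by linarith)
        have e2 := hk₂' ((u + c) * (u + 2 * r + c)) (by gcongr <;> linarith)
          (by gcongr; linarith)
        have e3 : 1 ≤ r ^ (n - 2) := one_le_pow₀ hr1.le
        rw [Real.mul_rpow hu0.le (by linarith)]
        calc
          k₁ * k₂ * u ^ a = 1 * (u ^ a * k₁ * k₂) := by ring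
          _ ≤ _ := by gcongr
      _ ≤ _ := by
        refine (lintegral_mono_set fun x hx ↦ zero_lt_one.trans hx.1).trans ?_
        exact lintegral_mono fun r ↦ lintegral_mono_set fun x hx ↦ hx.1
  · by_contra! ha
    refine h.ne (ENNReal.mul_eq_top.2 (.inl ⟨hk0, ?_⟩))
    obtain ⟨k₁, hk₁, hk₁'⟩ := exists_pos_le_rpow 8 two_pos a
    obtain ⟨k₂, hk₂, hk₂'⟩ := exists_pos_le_rpow ((2 + c) * (4 + c))
      (show 0 < c * 2 by positivity) (-t)
    have hK : 0 < k₁ * k₂ := by positivity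
    refine top_unique ?_
    calc
      ⊤ = ∫⁻ r in Set.Ioi (1 : ℝ), ENNReal.ofReal (k₁ * k₂) *
            ENNReal.ofReal (r ^ (a - t + n - 2)) := by
        rw [lintegral_const_mul' _ _ (by simp), lintegral_rpow_Ioi_eq_top ha,
          ENNReal.mul_top (by simpa using hK)]
      _ = ∫⁻ r in Set.Ioi (1 : ℝ), ∫⁻ u in Set.Ioo (1 : ℝ) 2, ENNReal.ofReal (k₁ * k₂) *
            ENNReal.ofReal (r ^ (a - t + n - 2)) := by
        simp
        norm_num
      _ ≤ ∫⁻ r in Set.Ioi (1 : ℝ), ∫⁻ u in Set.Ioo (1 : ℝ) 2, ENNReal.ofReal (r ^ (n - 2)) *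
          ENNReal.ofReal ((u * (u + 2 * r)) ^ a * ((u + c) * (u + 2 * r + c)) ^ (-t)) := by
        refine setLIntegral_mono' measurableSet_Ioi fun r hr1 ↦
          setLIntegral_mono' measurableSet_Ioo fun u ⟨hu1, hu2⟩ ↦ ?_
        have hr1 : 1 < r := hr1
        have hr0 : 0 < r := by linarith
        rw [← ENNReal.ofReal_mul (by positivity), ← ENNReal.ofReal_mul (by positivity)]
        refine ENNReal.ofReal_le_ofReal ?_
        have hcr : c ≤ c * r := le_mul_of_one_le_right hc.le hr1.le
        have e1 := hk₁' (u * (u + 2 * r) / r) (by rw [le_div_iff₀ hr0]; nlinarith)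
          (by rw [div_le_iff₀ hr0]; nlinarith)
        have e2 := hk₂' ((u + c) * ((u + 2 * r + c) / r))
          (by gcongr
              · linarith
              · rw [le_div_iff₀ hr0]; linarith)
          (by gcongr
              rw [div_le_iff₀ hr0]; nlinarith)
        have f1 : (u * (u + 2 * r)) ^ a = (u * (u + 2 * r) / r) ^ a * r ^ a := by
          rw [← Real.mul_rpow (by positivity) hr0.le, div_mul_cancel₀ _ hr0.ne']
        have f2 : ((u + c) * (u + 2 * r + c)) ^ (-t) =
            ((u + c) * ((u + 2 * r + c) / r)) ^ (-t) * r ^ (-t) := by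
          rw [← Real.mul_rpow (by positivity) hr0.le, mul_assoc (u + c), div_mul_cancel₀ _ hr0.ne']
        have f3 : r ^ (a - t + n - 2) = r ^ (n - 2) * r ^ a * r ^ (-t) := by
          rw [← Real.rpow_natCast, hcast, ← Real.rpow_add hr0, ← Real.rpow_add hr0]
          ring_nf
        rw [f1, f2, f3]
        calc
          k₁ * k₂ * (r ^ (n - 2) * r ^ a * r ^ (-t))
              = r ^ (n - 2) * (k₁ * r ^ a * (k₂ * r ^ (-t))) := by ring
          _ ≤ _ := by gcongr
      _ ≤ _ := by
        refine (lintegral_mono_set (Set.Ioi_subset_Ioi zero_le_one)).trans ?_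
        exact lintegral_mono fun r ↦ lintegral_mono_set fun x hx ↦ zero_lt_one.trans hx.1

theorem coneNorm_one (ν : ℝ) (g : (Fin n → ℝ) → ℝ) : coneNorm n 1 ν g =
    ∫⁻ y in lCone n, ENNReal.ofReal (|g y| * lDelta n y ^ (ν - (n : ℝ) / 2)) := by
  simp [coneNorm]

theorem coneNorm_one_comp_smul (ν : ℝ) (g : (Fin n → ℝ) → ℝ) {c : ℝ} (hc : 0 < c) :
    coneNorm n 1 ν (fun x ↦ g (c⁻¹ • x)) =
      ENNReal.ofReal (c ^ (2 * ν)) * coneNorm n 1 ν g := by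
  rw [coneNorm_one, coneNorm_one, ← setLIntegral_lCone_comp_smul hc,
    ← lintegral_const_mul' _ _ (by simp), ← lintegral_const_mul' _ _ (by simp)]
  refine setLIntegral_congr_fun measurableSet_lCone fun y hy ↦ ?_
  rw [← ENNReal.ofReal_mul (by positivity), ← ENNReal.ofReal_mul (by positivity), smul_smul,
    inv_mul_cancel₀ hc.ne', one_smul, lDelta_smul, Real.mul_rpow (by positivity) hy.1.le,
    show c ^ (2 * ν) = c ^ n * (c ^ 2) ^ (ν - (n : ℝ) / 2) by
      rw [← Real.rpow_natCast, ← Real.rpow_natCast, ← Real.rpow_mul hc.le, ← Real.rpow_add hc]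
      congr 1
      push_cast
      ring]
  congr 1
  ring

theorem Sop_comp_smul (α β γ : ℝ) (g : (Fin n → ℝ) → ℝ) {c : ℝ} (hc : 0 < c)
    {y : Fin n → ℝ} (hy : y ∈ lCone n) :
    Sop n α β γ (fun x ↦ g (c⁻¹ • x)) (c • y) =
      ENNReal.ofReal (c ^ (2 * (α + β - γ) + n)) * Sop n α β γ g y := by
  have hy0 : 0 < lDelta n y := hy.1
  rw [Sop, Sop, ← setLIntegral_lCone_comp_smul hc,
    ← lintegral_const_mul' _ _ (by simp), ← lintegral_const_mul' _ _ (by simp),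
    ← lintegral_const_mul' _ _ (by simp), ← lintegral_const_mul' _ _ (by simp)]
  refine setLIntegral_congr_fun measurableSet_lCone fun x hx ↦ ?_
  have hxy := (add_mem_lCone hy hx).1
  rw [← ENNReal.ofReal_mul (by positivity), ← ENNReal.ofReal_mul (by rw [lDelta_smul]; positivity),
    ← ENNReal.ofReal_mul (by positivity), ← ENNReal.ofReal_mul (by positivity), smul_smul,
    inv_mul_cancel₀ hc.ne', one_smul, ← smul_add, lDelta_smul, lDelta_smul, lDelta_smul,
    Real.mul_rpow (by positivity) hx.1.le, Real.mul_rpow (by positivity) hy.1.le,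
    Real.mul_rpow (by positivity) hxy.le,
    show c ^ (2 * (α + β - γ) + n) = c ^ n * (c ^ 2) ^ α * (c ^ 2) ^ β * (c ^ 2) ^ (-γ) by
      rw [← Real.rpow_natCast, ← Real.rpow_natCast, ← Real.rpow_mul hc.le, ← Real.rpow_mul hc.le,
        ← Real.rpow_mul hc.le, ← Real.rpow_add hc, ← Real.rpow_add hc, ← Real.rpow_add hc]
      congr 1
      push_cast
      ring]
  congr 1
  ring

theorem SopNorm_comp_smul (α β γ μ : ℝ) {q : ℝ} (hq : 0 < q) (g : (Fin n → ℝ) → ℝ) {c : ℝ}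
    (hc : 0 < c) : SopNorm n α β γ q μ (fun x ↦ g (c⁻¹ • x)) =
      ENNReal.ofReal (c ^ (2 * (α + β - γ + μ / q) + n)) * SopNorm n α β γ q μ g := by
  have h1 : ENNReal.ofReal (c ^ (2 * (α + β - γ + μ / q) + n)) =
      ENNReal.ofReal (c ^ (q * (2 * (α + β - γ) + n) + 2 * μ)) ^ (1 / q) := by
    rw [ENNReal.ofReal_rpow_of_pos (by positivity), ← Real.rpow_mul hc.le]
    congr 2
    field_simp
    ring
  rw [SopNorm, SopNorm, h1, ← ENNReal.mul_rpow_of_nonneg _ _ (by positivity),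
    ← setLIntegral_lCone_comp_smul hc, ← lintegral_const_mul' _ _ (by simp),
    ← lintegral_const_mul' _ _ (by simp)]
  congr 1
  refine setLIntegral_congr_fun measurableSet_lCone fun y hy ↦ ?_
  have hy0 : 0 < lDelta n y := hy.1
  rw [Sop_comp_smul α β γ g hc hy, lDelta_smul, ENNReal.mul_rpow_of_nonneg _ _ hq.le,
    Real.mul_rpow (by positivity) hy0.le, ENNReal.ofReal_mul (by positivity),
    ENNReal.ofReal_rpow_of_pos (by positivity),
    show c ^ (q * (2 * (α + β - γ) + n) + 2 * μ) =
      c ^ n * (c ^ (2 * (α + β - γ) + n)) ^ q * (c ^ 2) ^ (μ - (n : ℝ) / 2) by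
      rw [← Real.rpow_natCast, ← Real.rpow_natCast, ← Real.rpow_mul hc.le, ← Real.rpow_mul hc.le,
        ← Real.rpow_add hc, ← Real.rpow_add hc]
      congr 1
      push_cast
      ring,
    ENNReal.ofReal_mul (by positivity), ENNReal.ofReal_mul (by positivity)]
  ring

theorem eq_zero_of_forall_rpow_mul_le {d : ℝ} {A B : ℝ≥0∞} (hA : A ≠ 0) (hB : B ≠ ⊤)
    (h : ∀ c : ℝ, 0 < c → ENNReal.ofReal (c ^ d) * A ≤ B) : d = 0 := by
  by_contra hd
  have h1 (M : NNReal) (hM : 0 < M) : (M : ℝ≥0∞) * A ≤ B := by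
    have := h ((M : ℝ) ^ d⁻¹) (by positivity)
    rwa [← Real.rpow_mul (by positivity), inv_mul_cancel₀ hd, Real.rpow_one,
      ENNReal.ofReal_coe_nnreal] at this
  have hA' : A ≠ ⊤ := fun h' ↦ hB (top_unique (by simpa [h'] using h1 1 one_pos))
  have hBA : B / A ≠ ⊤ := ENNReal.div_ne_top hB hA
  have h2 := h1 ((B / A).toNNReal + 1) (by positivity)
  rw [← ENNReal.le_div_iff_mul_le (.inl hA) (.inl hA')] at h2
  push_cast [ENNReal.coe_toNNReal hBA] at h2
  exact (ENNReal.lt_add_right hBA one_ne_zero).not_ge h2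

theorem lintegral_mul_rpow_le {X : Type*} [MeasurableSpace X] (μ : Measure X) {q : ℝ} (hq : 1 < q)
    {K f : X → ℝ≥0∞} (hK : Measurable K) (hf : Measurable f) :
    (∫⁻ x, K x * f x ∂μ) ^ q ≤ (∫⁻ x, f x ∂μ) ^ (q - 1) * ∫⁻ x, K x ^ q * f x ∂μ := by
  have hq0 : 0 < q := by linarith
  have hpq := Real.HolderConjugate.conjExponent hq
  set p := q.conjExponent
  have hp0 : 0 < p := hpq.symm.pos
  have h1 := ENNReal.lintegral_mul_le_Lp_mul_Lq μ hpq (f := fun x ↦ K x * f x ^ (1 / q))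
    (g := fun x ↦ f x ^ (1 / p)) (by fun_prop) (by fun_prop)
  have h2 (x : X) : K x * f x ^ (1 / q) * f x ^ (1 / p) = K x * f x := by
    rw [mul_assoc, ← ENNReal.rpow_add_of_nonneg _ _ (by positivity) (by positivity)]
    simp [hpq.inv_add_inv_eq_one]
  have h3 (x : X) : (K x * f x ^ (1 / q)) ^ q = K x ^ q * f x := by
    rw [ENNReal.mul_rpow_of_nonneg _ _ hq0.le, ← ENNReal.rpow_mul, one_div_mul_cancel hq0.ne',
      ENNReal.rpow_one]
  have h4 (x : X) : (f x ^ (1 / p)) ^ p = f x := by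
    rw [← ENNReal.rpow_mul, one_div_mul_cancel hp0.ne', ENNReal.rpow_one]
  simp only [Pi.mul_apply, h2, h3, h4] at h1
  refine (ENNReal.rpow_le_rpow h1 hq0.le).trans_eq ?_
  rw [ENNReal.mul_rpow_of_nonneg _ _ hq0.le, ← ENNReal.rpow_mul, ← ENNReal.rpow_mul,
    one_div_mul_cancel hq0.ne', ENNReal.rpow_one, mul_comm, one_div_mul_eq_div,
    hpq.div_conj_eq_sub_one]

theorem sBounded_of_coneBeta {α β γ ν μ q : ℝ} (hq : 1 < q)
    (hγ : γ = α + β + (n : ℝ) / 2 - ν + μ / q)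
    (hfin : coneBeta n (q * α + μ - n / 2) (q * γ) (Pi.single 0 1) < ⊤) :
    SBounded n α β γ 1 ν q μ := by
  have hq0 : 0 < q := by linarith
  set M := coneBeta n (q * α + μ - n / 2) (q * γ) (Pi.single 0 1) with hM
  refine ⟨(M ^ (1 / q)).toReal + 1, by positivity, fun g hg _ ↦ ?_⟩
  have hCM : M ^ (1 / q) ≤ ENNReal.ofReal ((M ^ (1 / q)).toReal + 1) := by
    rw [ENNReal.ofReal_add (by positivity) zero_le_one, ENNReal.ofReal_toReal]
    · exact le_self_add
    · exact (ENNReal.rpow_lt_top_of_nonneg (by positivity) hfin.ne).ne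
  refine le_trans ?_ (mul_le_mul_left hCM _)
  set f : (Fin n → ℝ) → ℝ≥0∞ := fun x ↦ ENNReal.ofReal (|g x| * lDelta n x ^ (ν - (n : ℝ) / 2))
    with hf
  have hfm : Measurable f := by fun_prop
  set K : (Fin n → ℝ) → (Fin n → ℝ) → ℝ≥0∞ := fun y x ↦
    ENNReal.ofReal (lDelta n y ^ α * lDelta n (y + x) ^ (-γ) *
      lDelta n x ^ (β - ν + (n : ℝ) / 2)) with hK
  have hKm : Measurable (Function.uncurry K) := by
    simp only [hK, Function.uncurry_def]
    fun_prop
  set w : (Fin n → ℝ) → ℝ≥0∞ := fun y ↦ ENNReal.ofReal (lDelta n y ^ (μ - (n : ℝ) / 2)) with hw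
  have hwm : Measurable w := by fun_prop
  have hS {y : Fin n → ℝ} (hy : y ∈ lCone n) : Sop n α β γ g y = ∫⁻ x in lCone n, K y x * f x := by
    rw [Sop, ← lintegral_const_mul' _ _ (by simp)]
    refine setLIntegral_congr_fun measurableSet_lCone fun x hx ↦ ?_
    have hy0 : 0 < lDelta n y := hy.1
    have hxy : 0 < lDelta n (y + x) := (add_mem_lCone hy hx).1
    have hx0 : 0 < lDelta n x := hx.1
    rw [hK, hf, ← ENNReal.ofReal_mul (by positivity), ← ENNReal.ofReal_mul (by positivity),
      show lDelta n x ^ β = lDelta n x ^ (β - ν + (n : ℝ) / 2) * lDelta n x ^ (ν - (n : ℝ) / 2) by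
        rw [← Real.rpow_add hx0]
        ring_nf]
    congr 1
    ring
  have hKx {x : Fin n → ℝ} (hx : x ∈ lCone n) : ∫⁻ y in lCone n, K y x ^ q * w y = M := by
    have hx0 : 0 < lDelta n x := hx.1
    have h1 : ∫⁻ y in lCone n, K y x ^ q * w y =
        ENNReal.ofReal (lDelta n x ^ (q * (β - ν + (n : ℝ) / 2))) *
          coneBeta n (q * α + μ - n / 2) (q * γ) x := by
      rw [coneBeta, ← lintegral_const_mul' _ _ (by simp)]
      refine setLIntegral_congr_fun measurableSet_lCone fun y hy ↦ ?_
      have hy0 : 0 < lDelta n y := hy.1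
      have hxy : 0 < lDelta n (x + y) := (add_mem_lCone hx hy).1
      simp only [hK, hw]
      rw [add_comm y, ENNReal.ofReal_rpow_of_pos (by positivity),
        ← ENNReal.ofReal_mul (by positivity), ← ENNReal.ofReal_mul (by positivity),
        Real.mul_rpow (by positivity) (by positivity),
        Real.mul_rpow (by positivity) (by positivity), ← Real.rpow_mul hy0.le,
        ← Real.rpow_mul hxy.le, ← Real.rpow_mul hx0.le,
        show q * α + μ - (n : ℝ) / 2 = α * q + (μ - (n : ℝ) / 2) by ring, Real.rpow_add hy0,
        show -γ * q = -(q * γ) by ring, mul_comm q (β - ν + (n : ℝ) / 2)]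
      congr 1
      ring
    rw [h1, coneBeta_eq hx, ← hM, ← mul_assoc, ← ENNReal.ofReal_mul (by positivity),
      ← Real.rpow_add hx0,
      show q * (β - ν + (n : ℝ) / 2) + (q * α + μ - n / 2 - q * γ + n / 2) = 0 by
        rw [hγ]
        field_simp
        ring]
    simp
  rw [coneNorm_one, SopNorm]
  set N := ∫⁻ x in lCone n, f x with hN
  have hmain : ∫⁻ y in lCone n, Sop n α β γ g y ^ q * w y ≤ M * N ^ q := by
    calc
      _ ≤ ∫⁻ y in lCone n, N ^ (q - 1) * ∫⁻ x in lCone n, K y x ^ q * w y * f x := by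
        refine setLIntegral_mono' measurableSet_lCone fun y hy ↦ ?_
        have hKy : Measurable (K y) := hKm.of_uncurry_left
        rw [hS hy]
        refine (mul_le_mul_left (lintegral_mul_rpow_le _ hq hKy hfm) _).trans_eq ?_
        have hwt : w y ≠ ⊤ := ENNReal.ofReal_ne_top
        rw [mul_assoc, ← lintegral_mul_const' _ _ hwt]
        simp only [mul_right_comm, ← hN]
      _ = N ^ (q - 1) * ∫⁻ x in lCone n, ∫⁻ y in lCone n, K y x ^ q * w y * f x := by
        have hm : Measurable (Function.uncurry fun y x ↦ K y x ^ q * w y * f x) := by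
          simp only [Function.uncurry_def]
          exact ((hKm.pow_const q).mul (hwm.comp measurable_fst)).mul (hfm.comp measurable_snd)
        rw [lintegral_const_mul _ hm.lintegral_prod_right, lintegral_lintegral_swap hm.aemeasurable]
      _ = N ^ (q - 1) * ∫⁻ x in lCone n, M * f x := by
        congr 1
        refine setLIntegral_congr_fun measurableSet_lCone fun x hx ↦ ?_
        rw [lintegral_mul_const' _ _ ENNReal.ofReal_ne_top, hKx hx]
      _ = M * N ^ q := by
        rw [lintegral_const_mul' _ _ hfin.ne, ← hN, mul_left_comm]
        congr 1
        nth_rw 2 [← ENNReal.rpow_one N]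
        rw [← ENNReal.rpow_add_of_nonneg _ _ (by linarith) zero_le_one, sub_add_cancel]
  refine (ENNReal.rpow_le_rpow hmain (by positivity)).trans_eq ?_
  rw [ENNReal.mul_rpow_of_nonneg _ _ (by positivity), ← ENNReal.rpow_mul, mul_one_div_cancel hq0.ne',
    ENNReal.rpow_one]

/-- A bounded neighbourhood of the base point on which `lDelta n (y + x)` is comparable to its
value at multiples of the base point, uniformly in `y`. -/
def lNhd (n : ℕ) [NeZero n] : Set (Fin n → ℝ) :=
  {x | x - (1 / 2 : ℝ) • Pi.single 0 1 ∈ lCone n ∧ (2 : ℝ) • Pi.single 0 1 - x ∈ lCone n}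

theorem isOpen_lNhd : IsOpen (lNhd n) :=
  (isOpen_lCone.preimage (by fun_prop)).inter (isOpen_lCone.preimage (by fun_prop))

theorem single_mem_lNhd : Pi.single 0 1 ∈ lNhd n := by
  have h1 : (Pi.single 0 1 : Fin n → ℝ) - (1 / 2 : ℝ) • Pi.single 0 1 =
      (1 / 2 : ℝ) • Pi.single 0 1 := by module
  have h2 : (2 : ℝ) • (Pi.single 0 1 : Fin n → ℝ) - Pi.single 0 1 =
      (1 : ℝ) • Pi.single 0 1 := by module
  rw [lNhd, Set.mem_ofPred_eq, h1, h2]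
  exact ⟨smul_mem_lCone (by norm_num) single_mem_lCone,
    smul_mem_lCone (by norm_num) single_mem_lCone⟩

theorem lNhd_subset_lCone : lNhd n ⊆ lCone n := fun x hx ↦ by
  simpa using add_mem_lCone hx.1 (smul_mem_lCone (show (0 : ℝ) < 1 / 2 by norm_num)
    single_mem_lCone)

theorem lDelta_add_bounds {x y : Fin n → ℝ} (hx : x ∈ lNhd n) (hy : y ∈ lCone n) :
    lDelta n ((1 / 2 : ℝ) • Pi.single 0 1 + y) ≤ lDelta n (y + x) ∧
      lDelta n (y + x) ≤ lDelta n ((2 : ℝ) • Pi.single 0 1 + y) := by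
  constructor
  · have h := lDelta_lt_lDelta_add (add_mem_lCone (smul_mem_lCone (show (0 : ℝ) < 1 / 2 by norm_num)
      single_mem_lCone) hy) hx.1
    rw [show (1 / 2 : ℝ) • Pi.single 0 1 + y + (x - (1 / 2 : ℝ) • Pi.single 0 1) = y + x by abel]
      at h
    exact h.le
  · have h := lDelta_lt_lDelta_add (add_mem_lCone hy (lNhd_subset_lCone hx)) hx.2
    rw [show y + x + ((2 : ℝ) • Pi.single 0 1 - x) = (2 : ℝ) • Pi.single 0 1 + y by abel] at h
    exact h.le

theorem lDelta_bounds {x : Fin n → ℝ} (hx : x ∈ lNhd n) :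
    1 / 4 ≤ lDelta n x ∧ lDelta n x ≤ 4 := by
  constructor
  · have h := lDelta_lt_lDelta_add (smul_mem_lCone (show (0 : ℝ) < 1 / 2 by norm_num)
      single_mem_lCone) hx.1
    rw [add_sub_cancel, lDelta_smul, lDelta_single] at h
    linarith
  · have h := lDelta_lt_lDelta_add (lNhd_subset_lCone hx) hx.2
    rw [add_sub_cancel, lDelta_smul, lDelta_single] at h
    linarith

theorem volume_lNhd_ne_top : volume (lNhd n) ≠ ⊤ := by
  refine ne_top_of_le_ne_top
    (measure_closedBall_lt_top (μ := volume) (x := (0 : Fin n → ℝ)) (r := 2)).ne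
    (measure_mono fun x hx ↦ ?_)
  rw [mem_closedBall_zero_iff, pi_norm_le_iff_of_nonneg zero_le_two]
  intro i
  have h := hx.2.2
  simp at h
  exact (abs_apply_le_of_mem_lCone (lNhd_subset_lCone hx) i).trans h.le

theorem coneNorm_one_indicator_lNhd_lt_top (ν : ℝ) :
    coneNorm n 1 ν ((lNhd n).indicator 1) < ⊤ := by
  obtain ⟨k, hk, hk'⟩ := exists_pos_le_rpow 4 (show (0 : ℝ) < 1 / 4 by norm_num)
    (-(ν - (n : ℝ) / 2))
  rw [coneNorm_one]
  calc
    _ ≤ ∫⁻ x, (lNhd n).indicator (fun _ ↦ ENNReal.ofReal k⁻¹) x := by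
      refine (setLIntegral_le_lintegral _ _).trans (lintegral_mono fun x ↦ ?_)
      by_cases hx : x ∈ lNhd n
      · obtain ⟨h1, h2⟩ := lDelta_bounds hx
        have h3 := hk' _ h1 h2
        rw [Real.rpow_neg (by linarith)] at h3
        simpa [hx] using ENNReal.ofReal_le_ofReal (le_inv_of_le_inv₀ hk h3)
      · simp [hx]
    _ < ⊤ := by
      rw [lintegral_indicator_const isOpen_lNhd.measurableSet]
      exact ENNReal.mul_lt_top (by simp) volume_lNhd_ne_top.lt_top

theorem exists_le_Sop_indicator_lNhd (α β γ : ℝ) : ∃ k > 0, ∃ c > (0 : ℝ), ∀ y ∈ lCone n,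
    ENNReal.ofReal (k * (lDelta n y ^ α * lDelta n (c • Pi.single 0 1 + y) ^ (-γ))) ≤
      Sop n α β γ ((lNhd n).indicator 1) y := by
  obtain ⟨k, hk, hk'⟩ := exists_pos_le_rpow 4 (show (0 : ℝ) < 1 / 4 by norm_num) β
  obtain ⟨c, hc, hc'⟩ : ∃ c > (0 : ℝ), ∀ y ∈ lCone n, ∀ x ∈ lNhd n,
      lDelta n (c • Pi.single 0 1 + y) ^ (-γ) ≤ lDelta n (y + x) ^ (-γ) := by
    rcases le_total 0 γ with h | h
    · exact ⟨2, two_pos, fun y hy x hx ↦ Real.rpow_le_rpow_of_nonpos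
        (add_mem_lCone hy (lNhd_subset_lCone hx)).1 (lDelta_add_bounds hx hy).2 (by linarith)⟩
    · exact ⟨1 / 2, by norm_num, fun y hy x hx ↦ Real.rpow_le_rpow
        (add_mem_lCone (smul_mem_lCone (by norm_num) single_mem_lCone) hy).1.le
        (lDelta_add_bounds hx hy).1 (by linarith)⟩
  have hV : 0 < (volume (lNhd n)).toReal :=
    ENNReal.toReal_pos (isOpen_lNhd.measure_pos _ ⟨_, single_mem_lNhd⟩).ne' volume_lNhd_ne_top
  refine ⟨k * (volume (lNhd n)).toReal, by positivity, c, hc, fun y hy ↦ ?_⟩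
  have hy0 : 0 < lDelta n y := hy.1
  have hcy : 0 < lDelta n (c • Pi.single 0 1 + y) :=
    (add_mem_lCone (smul_mem_lCone hc single_mem_lCone) hy).1
  calc
    _ = ENNReal.ofReal (lDelta n y ^ α) * ∫⁻ x in lNhd n,
          ENNReal.ofReal (lDelta n (c • Pi.single 0 1 + y) ^ (-γ) * k) := by
      rw [setLIntegral_const, ← ENNReal.ofReal_toReal volume_lNhd_ne_top,
        ← ENNReal.ofReal_mul (by positivity), ← ENNReal.ofReal_mul (by positivity),
        ENNReal.ofReal_toReal volume_lNhd_ne_top]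
      congr 1
      ring
    _ ≤ ENNReal.ofReal (lDelta n y ^ α) * ∫⁻ x in lNhd n, ENNReal.ofReal
          (lDelta n (y + x) ^ (-γ) * |(lNhd n).indicator 1 x| * lDelta n x ^ β) := by
      refine mul_le_mul_right (setLIntegral_mono' isOpen_lNhd.measurableSet fun x hx ↦ ?_) _
      refine ENNReal.ofReal_le_ofReal ?_
      have hxy : 0 < lDelta n (y + x) := (add_mem_lCone hy (lNhd_subset_lCone hx)).1
      simp only [Set.indicator_of_mem hx, Pi.one_apply, abs_one, mul_one]
      exact mul_le_mul (hc' y hy x hx) (hk' _ (lDelta_bounds hx).1 (lDelta_bounds hx).2) hk.le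
        (by positivity)
    _ ≤ _ := mul_le_mul_right (lintegral_mono_set lNhd_subset_lCone) _

theorem exists_coneBeta_le_SopNorm (α β γ μ : ℝ) {q : ℝ} (hq : 0 < q) : ∃ k : ℝ≥0∞, k ≠ 0 ∧
    ∃ c > (0 : ℝ), k * coneBeta n (q * α + μ - n / 2) (q * γ) (c • Pi.single 0 1) ≤
      SopNorm n α β γ q μ ((lNhd n).indicator 1) ^ q := by
  obtain ⟨k, hk, c, hc, h⟩ := exists_le_Sop_indicator_lNhd (n := n) α β γ
  refine ⟨ENNReal.ofReal (k ^ q), by simpa using by positivity, c, hc, ?_⟩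
  rw [SopNorm, ← ENNReal.rpow_mul, one_div_mul_cancel hq.ne', ENNReal.rpow_one, coneBeta,
    ← lintegral_const_mul' _ _ (by simp)]
  refine setLIntegral_mono' measurableSet_lCone fun y hy ↦ ?_
  have hy0 : 0 < lDelta n y := hy.1
  have hcy : 0 < lDelta n (c • Pi.single 0 1 + y) :=
    (add_mem_lCone (smul_mem_lCone hc single_mem_lCone) hy).1
  refine le_trans (le_of_eq ?_) (mul_le_mul_left (ENNReal.rpow_le_rpow (h y hy) hq.le) _)
  rw [ENNReal.ofReal_rpow_of_pos (by positivity), ← ENNReal.ofReal_mul (by positivity),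
    ← ENNReal.ofReal_mul (by positivity), Real.mul_rpow (by positivity) (by positivity),
    Real.mul_rpow (by positivity) (by positivity), ← Real.rpow_mul hy0.le, ← Real.rpow_mul hcy.le,
    show q * α + μ - (n : ℝ) / 2 = α * q + (μ - (n : ℝ) / 2) by ring, Real.rpow_add hy0,
    show -γ * q = -(q * γ) by ring]
  congr 1
  ring

theorem coneBeta_ne_zero (a t : ℝ) {x : Fin n → ℝ} (hx : x ∈ lCone n) : coneBeta n a t x ≠ 0 := by
  rw [coneBeta, ne_eq, lintegral_eq_zero_iff (by fun_prop)]
  intro h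
  have h1 : ∀ᵐ y ∂volume.restrict (lCone n), False := by
    filter_upwards [h, ae_restrict_mem measurableSet_lCone] with y h hy
    have hy0 : 0 < lDelta n y := hy.1
    have hxy : 0 < lDelta n (x + y) := (add_mem_lCone hx hy).1
    have : 0 < lDelta n y ^ a * lDelta n (x + y) ^ (-t) := by positivity
    simp only [Pi.zero_apply, ENNReal.ofReal_eq_zero] at h
    linarith
  rw [Filter.eventually_false_iff_eq_bot, ae_eq_bot, Measure.restrict_eq_zero] at h1
  exact (isOpen_lCone.measure_pos volume ⟨_, single_mem_lCone⟩).ne' h1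

end Lorentz

/-- Theorem 2.2 of the paper on the rank-2 Lorentz cone (first limit case, `p = 1`). -/
theorem statement1 (n : ℕ) [NeZero n] (hn : 3 ≤ n) (α β γ ν μ q : ℝ)
    (hq : 1 < q) (hμ : 0 < μ) :
    SBounded n α β γ 1 ν q μ ↔
      (γ = α + β + (n : ℝ) / 2 - ν + μ / q ∧
        0 < γ ∧
        ((n : ℝ) / 2 - 1 - q * α < μ ∧ μ < q * (γ - α) - (n : ℝ) / 2 + 1)) := by
  have hq0 : 0 < q := by linarith
  have hn' : (3 : ℝ) ≤ n := by exact_mod_cast hn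
  constructor
  · rintro ⟨C, hC, h⟩
    have hgm : Measurable ((lNhd n).indicator (1 : (Fin n → ℝ) → ℝ)) :=
      measurable_one.indicator isOpen_lNhd.measurableSet
    have hg := coneNorm_one_indicator_lNhd_lt_top (n := n) ν
    set g := (lNhd n).indicator (1 : (Fin n → ℝ) → ℝ)
    have hB : ENNReal.ofReal C * coneNorm n 1 ν g ≠ ⊤ := (ENNReal.mul_lt_top (by simp) hg).ne
    obtain ⟨k, hk, c, hc, hle⟩ := exists_coneBeta_le_SopNorm (n := n) α β γ μ hq0
    have hA_top : SopNorm n α β γ q μ g ≠ ⊤ := ne_top_of_le_ne_top hB (h g hgm hg)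
    have hbeta_top : coneBeta n (q * α + μ - n / 2) (q * γ) (c • Pi.single 0 1) < ⊤ := by
      refine lt_top_iff_ne_top.2 fun h' ↦ ?_
      rw [h', ENNReal.mul_top hk, top_le_iff] at hle
      exact ENNReal.rpow_ne_top_of_nonneg hq0.le hA_top hle
    have hA : SopNorm n α β γ q μ g ≠ 0 := by
      intro h'
      rw [h', ENNReal.zero_rpow_of_pos hq0, nonpos_iff_eq_zero, mul_eq_zero] at hle
      exact hle.elim hk (coneBeta_ne_zero _ _ (smul_mem_lCone hc single_mem_lCone))
    have hd := eq_zero_of_forall_rpow_mul_le (d := 2 * (α + β - γ + μ / q) + n - 2 * ν) hA hB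
      fun s hs ↦ by
        have h1 := h (fun x ↦ g (s⁻¹ • x)) (by fun_prop) (by
          rw [coneNorm_one_comp_smul ν g hs]
          exact ENNReal.mul_lt_top (by simp) hg)
        rw [coneNorm_one_comp_smul ν g hs, SopNorm_comp_smul α β γ μ hq0 g hs, mul_left_comm] at h1
        rw [sub_eq_add_neg, add_comm, Real.rpow_add hs, ENNReal.ofReal_mul (by positivity),
          mul_assoc]
        refine (mul_le_mul_right h1 _).trans_eq ?_
        rw [← mul_assoc, ← ENNReal.ofReal_mul (by positivity), ← Real.rpow_add hs]
        simp
    obtain ⟨h1, h2⟩ := lt_of_coneBeta_lt_top (by omega) hc hbeta_top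
    refine ⟨by linarith, ?_, by linarith, by linarith⟩
    exact pos_of_mul_pos_right (show 0 < q * γ by linarith) hq0.le
  · rintro ⟨hγ, -, h1, h2⟩
    exact sBounded_of_coneBeta hq hγ (coneBeta_single_lt_top (by omega)
      (by linarith) (by linarith))
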